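/- Let n ≥ 1, s ∈ (0,1), p ∈ [1,∞), and let u : ℝⁿ → ℝ be a smooth function with compact support. Define K̄(t,u) = inf { ‖u − v‖_{L^p(ℝⁿ)} + t ‖∇v‖_{L^p(ℝⁿ)} : v smooth with compact support } for t > 0. Then for every y ∈ ℝⁿ, ‖ u(·+y) − u ‖_{L^p(ℝⁿ)} ≤ p^{1/p} · 2^{1−s} · |y|^s · ( s(1−s) ∫_0^∞ ( K̄(t,u) / t^s )^p dt/t )^{1/p}. -/

import Mathlib

open MeasureTheory

lemma norm_gradient_aux {n : ℕ} (v : EuclideanSpace ℝ (Fin n) → ℝ) (x : EuclideanSpace ℝ (Fin n)) :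
    ‖gradient v x‖ = ‖fderiv ℝ v x‖ := by
  unfold gradient
  exact LinearIsometryEquiv.norm_map _ _

lemma cont_gradient_aux {n : ℕ} (v : EuclideanSpace ℝ (Fin n) → ℝ) (hv : ContDiff ℝ (⊤ : ℕ∞) v) :
    Continuous (fun x => gradient v x) := by
  unfold gradient
  exact (LinearIsometryEquiv.continuous _).comp (hv.continuous_fderiv (by simp))

lemma ptwise_aux {n : ℕ} (v : EuclideanSpace ℝ (Fin n) → ℝ) (hv : ContDiff ℝ (⊤ : ℕ∞) v)
    (x y : EuclideanSpace ℝ (Fin n)) :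
    ‖v (x + y) - v x‖ₑ ≤ ‖y‖ₑ * ∫⁻ t in Set.Ioc (0:ℝ) 1, ‖gradient v (x + t • y)‖ₑ := by
  have hc : Continuous (fun t : ℝ => fderiv ℝ v (x + t • y) y) := by
    have := hv.continuous_fderiv (by simp)
    exact (this.comp (by fun_prop : Continuous fun t : ℝ => x + t • y)).clm_apply continuous_const
  have hd : ∀ t ∈ Set.uIcc (0:ℝ) 1, HasDerivAt (fun t : ℝ => v (x + t • y))
      (fderiv ℝ v (x + t • y) y) t := by
    intro t _
    have h1 : HasFDerivAt v (fderiv ℝ v (x + t • y)) (x + t • y) :=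
      (hv.differentiable (by simp) _).hasFDerivAt
    have h2 : HasDerivAt (fun t : ℝ => x + t • y) y t := by
      simpa using ((hasDerivAt_id t).smul_const y).const_add x
    exact h1.comp_hasDerivAt t h2
  have h := intervalIntegral.integral_eq_sub_of_hasDerivAt hd (hc.intervalIntegrable 0 1)
  simp only [one_smul, zero_smul, add_zero] at h
  rw [← h, intervalIntegral.integral_of_le zero_le_one]
  refine (enorm_integral_le_lintegral_enorm _).trans ?_
  rw [← lintegral_const_mul' _ _ enorm_ne_top]
  refine lintegral_mono fun t => ?_
  have : ‖gradient v (x + t • y)‖ₑ = ‖fderiv ℝ v (x + t • y)‖ₑ := by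
    rw [← ofReal_norm, ← ofReal_norm, norm_gradient_aux]
  rw [this, mul_comm]
  exact ContinuousLinearMap.le_opENorm _ _

lemma lint_aux {n : ℕ} (p : ℝ) (hp : 1 ≤ p)
    (v : EuclideanSpace ℝ (Fin n) → ℝ) (hv : ContDiff ℝ (⊤ : ℕ∞) v)
    (y : EuclideanSpace ℝ (Fin n)) :
    eLpNorm (fun x => v (x + y) - v x) (ENNReal.ofReal p) volume ≤
      ‖y‖ₑ * eLpNorm (fun x => gradient v x) (ENNReal.ofReal p) volume := by
  have hp0 : 0 < p := by linarith
  have hpe : ENNReal.ofReal p ≠ 0 := by simpa using hp0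
  have hpt : (ENNReal.ofReal p).toReal = p := ENNReal.toReal_ofReal hp0.le
  have hg := cont_gradient_aux v hv
  have : IsProbabilityMeasure (volume.restrict (Set.Ioc (0:ℝ) 1)) := ⟨by simp⟩
  have key : ∀ x, ‖v (x + y) - v x‖ₑ ^ p ≤
      ‖y‖ₑ ^ p * ∫⁻ t in Set.Ioc (0:ℝ) 1, ‖gradient v (x + t • y)‖ₑ ^ p := by
    intro x
    have hgx : Continuous (fun t : ℝ => gradient v (x + t • y)) := hg.comp (by fun_prop)
    have h1 := eLpNorm_le_eLpNorm_of_exponent_le (p := 1) (q := ENNReal.ofReal p)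
      (μ := volume.restrict (Set.Ioc (0:ℝ) 1)) (f := fun t : ℝ => gradient v (x + t • y))
      (by simpa using hp) hgx.aestronglyMeasurable
    rw [eLpNorm_one_eq_lintegral_enorm, eLpNorm_eq_lintegral_rpow_enorm_toReal hpe (by simp), hpt] at h1
    calc _ ≤ (‖y‖ₑ * ∫⁻ t in Set.Ioc (0:ℝ) 1, ‖gradient v (x + t • y)‖ₑ) ^ p :=
          ENNReal.rpow_le_rpow (ptwise_aux v hv x y) hp0.le
      _ ≤ _ := by
          rw [ENNReal.mul_rpow_of_nonneg _ _ hp0.le]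
          gcongr
          calc _ ≤ _ := ENNReal.rpow_le_rpow h1 hp0.le
            _ = _ := by rw [← ENNReal.rpow_mul, one_div, inv_mul_cancel₀ hp0.ne', ENNReal.rpow_one]
  rw [eLpNorm_eq_lintegral_rpow_enorm_toReal hpe (by simp),
    eLpNorm_eq_lintegral_rpow_enorm_toReal hpe (by simp), hpt]
  have hm : ∫⁻ x, ‖v (x + y) - v x‖ₑ ^ p ≤ ‖y‖ₑ ^ p * ∫⁻ x, ‖gradient v x‖ₑ ^ p := by
    calc _ ≤ ∫⁻ x, ‖y‖ₑ ^ p * ∫⁻ t in Set.Ioc (0:ℝ) 1, ‖gradient v (x + t • y)‖ₑ ^ p :=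
          lintegral_mono key
      _ = ‖y‖ₑ ^ p * ∫⁻ x, ∫⁻ t in Set.Ioc (0:ℝ) 1, ‖gradient v (x + t • y)‖ₑ ^ p :=
          lintegral_const_mul' _ _ (by simp [hp0.le])
      _ = ‖y‖ₑ ^ p * ∫⁻ t in Set.Ioc (0:ℝ) 1, ∫⁻ x, ‖gradient v (x + t • y)‖ₑ ^ p := by
          rw [lintegral_lintegral_swap]
          have : Continuous (fun q : EuclideanSpace ℝ (Fin n) × ℝ => gradient v (q.1 + q.2 • y)) :=
            hg.comp (by fun_prop)
          exact (this.measurable.enorm.pow_const p).aemeasurable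
      _ = _ := by
          congr 1
          have : ∀ t : ℝ, ∫⁻ x, ‖gradient v (x + t • y)‖ₑ ^ p = ∫⁻ x, ‖gradient v x‖ₑ ^ p :=
            fun t => lintegral_add_right_eq_self (fun x => ‖gradient v x‖ₑ ^ p) (t • y)
          simp [this]
  calc _ ≤ _ := ENNReal.rpow_le_rpow hm (by positivity : (0:ℝ) ≤ 1 / p)
    _ = _ := by
      rw [ENNReal.mul_rpow_of_nonneg _ _ (by positivity), ← ENNReal.rpow_mul, one_div,
        mul_inv_cancel₀ hp0.ne', ENNReal.rpow_one]

lemma main_aux {n : ℕ} (p : ℝ) (hp : 1 ≤ p)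
    (u v : EuclideanSpace ℝ (Fin n) → ℝ) (hu : ContDiff ℝ (⊤ : ℕ∞) u) (hsupp : HasCompactSupport u)
    (hv : ContDiff ℝ (⊤ : ℕ∞) v) (hvs : HasCompactSupport v)
    (y : EuclideanSpace ℝ (Fin n)) :
    (eLpNorm (fun x => u (x + y) - u x) (ENNReal.ofReal p) volume).toReal ≤
      2 * (eLpNorm (fun x => u x - v x) (ENNReal.ofReal p) volume).toReal +
      ‖y‖ * (eLpNorm (fun x => gradient v x) (ENNReal.ofReal p) volume).toReal := by
  have h1p : 1 ≤ ENNReal.ofReal p := by simpa using hp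
  have hwc : Continuous (fun x => u x - v x) := hu.continuous.sub hv.continuous
  have hw : MemLp (fun x => u x - v x) (ENNReal.ofReal p) volume :=
    hwc.memLp_of_hasCompactSupport (hsupp.sub hvs)
  have hgs : HasCompactSupport (fun x => gradient v x) := by
    have := hvs.fderiv (𝕜 := ℝ)
    refine this.mono' ?_
    intro x hx
    apply subset_tsupport
    simp only [Function.mem_support] at hx ⊢
    rw [← norm_ne_zero_iff] at hx ⊢
    rwa [norm_gradient_aux] at hx
  have hgm : MemLp (fun x => gradient v x) (ENNReal.ofReal p) volume :=
    (cont_gradient_aux v hv).memLp_of_hasCompactSupport hgs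
  have htr : eLpNorm (fun x => u (x + y) - v (x + y)) (ENNReal.ofReal p) volume =
      eLpNorm (fun x => u x - v x) (ENNReal.ofReal p) volume :=
    eLpNorm_comp_measurePreserving (g := fun x => u x - v x) hwc.aestronglyMeasurable
      (measurePreserving_add_right volume y)
  have hwy : Continuous (fun x => u (x + y) - v (x + y)) := hwc.comp (continuous_add_const y)
  have hvy : Continuous (fun x => v (x + y) - v x) :=
    (hv.continuous.comp (continuous_add_const y)).sub hv.continuous
  have hle : eLpNorm (fun x => u (x + y) - u x) (ENNReal.ofReal p) volume ≤
      eLpNorm (fun x => u x - v x) (ENNReal.ofReal p) volume +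
      eLpNorm (fun x => u x - v x) (ENNReal.ofReal p) volume +
      ‖y‖ₑ * eLpNorm (fun x => gradient v x) (ENNReal.ofReal p) volume := by
    have e : (fun x => u (x + y) - u x) = ((fun x => u (x + y) - v (x + y)) - (fun x => u x - v x))
        + (fun x => v (x + y) - v x) := by
      ext x; simp only [Pi.add_apply, Pi.sub_apply]; ring
    rw [e]
    refine (eLpNorm_add_le (hwy.sub hwc).aestronglyMeasurable hvy.aestronglyMeasurable h1p).trans ?_
    gcongr
    · refine (eLpNorm_sub_le hwy.aestronglyMeasurable hwc.aestronglyMeasurable h1p).trans ?_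
      rw [htr]
    · exact lint_aux p hp v hv y
  have ht1 := hw.eLpNorm_ne_top
  have ht2 := hgm.eLpNorm_ne_top
  have := ENNReal.toReal_mono (by finiteness) hle
  rw [ENNReal.toReal_add (by finiteness) (by finiteness), ENNReal.toReal_add ht1 ht1,
    ENNReal.toReal_mul, toReal_enorm] at this
  linarith

/-- the scalar part -/
lemma scalar_aux (s p : ℝ) (hs0 : 0 < s) (hs1 : s < 1) (hp : 1 ≤ p) (K : ℝ → ℝ)
    (D T A B : ℝ) (hT : 0 < T) (hD : 0 ≤ D)
    (hmono : MonotoneOn K (Set.Ioi 0))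
    (hA : ∀ t, 0 < t → K t ≤ A) (hB : ∀ t, 0 < t → K t ≤ t * B)
    (h1 : ∀ t, 0 < t → t ≤ T → D * (t / T) ≤ K t) (h2 : ∀ t, T < t → D ≤ K t) :
    D ≤ p ^ (1 / p) * T ^ s *
      (s * (1 - s) * ∫ t in Set.Ioi (0 : ℝ), (K t / t ^ s) ^ p / t) ^ (1 / p) := by
  have hp0 : 0 < p := by linarith
  have h1s : 0 < 1 - s := by linarith
  have hK0 : ∀ t, 0 < t → 0 ≤ K t := by
    intro t ht
    rcases le_or_gt t T with h | h
    · exact le_trans (by positivity) (h1 t ht h)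
    · exact hD.trans (h2 t h)
  have hA0 : 0 ≤ A := (hK0 T hT).trans (hA T hT)
  have hB0 : 0 ≤ B := by
    have := (hK0 1 one_pos).trans (hB 1 one_pos); linarith
  -- power identities
  have e1 : ∀ t : ℝ, 0 < t → ∀ c : ℝ, 0 ≤ c → ((t * c) / t ^ s) ^ p / t = c ^ p * t ^ (p * (1 - s) - 1) := by
    intro t ht c hc
    have : (t * c) / t ^ s = c * t ^ (1 - s) := by
      rw [Real.rpow_sub ht, Real.rpow_one]; ring
    rw [this, Real.mul_rpow hc (by positivity), ← Real.rpow_mul ht.le, Real.rpow_sub ht,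
      Real.rpow_one, mul_comm (1 - s) p]
    ring
  have e2 : ∀ t : ℝ, 0 < t → ∀ c : ℝ, 0 ≤ c → (c / t ^ s) ^ p / t = c ^ p * t ^ (- (s * p) - 1) := by
    intro t ht c hc
    rw [Real.div_rpow hc (by positivity), ← Real.rpow_mul ht.le, Real.rpow_sub ht,
      Real.rpow_one, Real.rpow_neg ht.le]
    ring
  have hps : 0 < p * (1 - s) := by positivity
  have hsp : 0 < s * p := by positivity
  have i1 : IntegrableOn (fun t : ℝ => t ^ (p * (1 - s) - 1)) (Set.Ioc 0 T) := by
    rw [← intervalIntegrable_iff_integrableOn_Ioc_of_le hT.le]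
    exact intervalIntegral.intervalIntegrable_rpow' (by linarith)
  have i2 : IntegrableOn (fun t : ℝ => t ^ (- (s * p) - 1)) (Set.Ioi T) :=
    integrableOn_Ioi_rpow_of_lt (by linarith) hT
  have v1 : ∫ t in Set.Ioc 0 T, t ^ (p * (1 - s) - 1) = T ^ (p * (1 - s)) / (p * (1 - s)) := by
    rw [← intervalIntegral.integral_of_le hT.le, integral_rpow (Or.inl (by linarith))]
    simp [Real.zero_rpow hps.ne']
  have v2 : ∫ t in Set.Ioi T, t ^ (- (s * p) - 1) = T ^ (- (s * p)) / (s * p) := by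
    rw [integral_Ioi_rpow_of_lt (by linarith) hT]
    simp [div_neg, neg_div]
  have hm : AEStronglyMeasurable (fun t => (K t / t ^ s) ^ p / t) (volume.restrict (Set.Ioi 0)) := by
    have hKm : AEMeasurable K (volume.restrict (Set.Ioi 0)) :=
      aemeasurable_restrict_of_monotoneOn measurableSet_Ioi hmono
    have : AEMeasurable (fun t => (K t / t ^ s) ^ p / t) (volume.restrict (Set.Ioi 0)) := by
      fun_prop
    exact this.aestronglyMeasurable
  have hm1 := hm.mono_set (Set.Ioc_subset_Ioi_self : Set.Ioc 0 T ⊆ Set.Ioi 0)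
  have hm2 := hm.mono_set (Set.Ioi_subset_Ioi hT.le : Set.Ioi T ⊆ Set.Ioi 0)
  have mono : ∀ t : ℝ, 0 < t → ∀ a b : ℝ, 0 ≤ a → a ≤ b → (a / t ^ s) ^ p / t ≤ (b / t ^ s) ^ p / t := by
    intro t ht a b ha hab
    gcongr
  have j1 : IntegrableOn (fun t => (K t / t ^ s) ^ p / t) (Set.Ioc 0 T) := by
    refine Integrable.mono' (i1.const_mul (B ^ p)) hm1 ?_
    filter_upwards [ae_restrict_mem measurableSet_Ioc] with t ht
    have := hK0 t ht.1
    have h0 := ht.1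
    rw [Real.norm_of_nonneg (by positivity), ← e1 t ht.1 B hB0]
    exact mono t h0 _ _ this (hB t h0)
  have j2 : IntegrableOn (fun t => (K t / t ^ s) ^ p / t) (Set.Ioi T) := by
    refine Integrable.mono' (i2.const_mul (A ^ p)) hm2 ?_
    filter_upwards [ae_restrict_mem measurableSet_Ioi] with t ht
    have h0 : 0 < t := hT.trans ht
    have := hK0 t h0
    rw [Real.norm_of_nonneg (by positivity), ← e2 t h0 A hA0]
    exact mono t h0 _ _ this (hA t h0)
  have l1 : (D / T) ^ p * (T ^ (p * (1 - s)) / (p * (1 - s))) ≤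
      ∫ t in Set.Ioc 0 T, (K t / t ^ s) ^ p / t := by
    rw [← v1, ← integral_const_mul]
    refine setIntegral_mono_on (i1.const_mul _) j1 measurableSet_Ioc fun t ht => ?_
    have h0 := ht.1
    rw [← e1 t h0 (D / T) (by positivity)]
    refine mono t h0 _ _ (by positivity) ?_
    calc _ = D * (t / T) := by ring
      _ ≤ _ := h1 t ht.1 ht.2
  have l2 : D ^ p * (T ^ (- (s * p)) / (s * p)) ≤
      ∫ t in Set.Ioi T, (K t / t ^ s) ^ p / t := by
    rw [← v2, ← integral_const_mul]
    refine setIntegral_mono_on (i2.const_mul _) j2 measurableSet_Ioi fun t ht => ?_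
    have h0 : 0 < t := hT.trans ht
    rw [← e2 t h0 D hD]
    exact mono t h0 _ _ hD (h2 t ht)
  have hsplit : ∫ t in Set.Ioi (0 : ℝ), (K t / t ^ s) ^ p / t =
      (∫ t in Set.Ioc 0 T, (K t / t ^ s) ^ p / t) + ∫ t in Set.Ioi T, (K t / t ^ s) ^ p / t := by
    rw [← Set.Ioc_union_Ioi_eq_Ioi hT.le]
    exact setIntegral_union (Set.Ioc_disjoint_Ioi le_rfl) measurableSet_Ioi j1 j2
  set I := ∫ t in Set.Ioi (0 : ℝ), (K t / t ^ s) ^ p / t with hI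
  have hTT : (D / T) ^ p * T ^ (p * (1 - s)) = D ^ p * T ^ (-(s * p)) := by
    rw [Real.div_rpow hD hT.le, show p * (1 - s) = p + -(s * p) by ring, Real.rpow_add hT]
    field_simp
  have hlow : (D * T ^ (-s)) ^ p / p ≤ s * (1 - s) * I := by
    have : (D * T ^ (-s)) ^ p = D ^ p * T ^ (-(s * p)) := by
      rw [Real.mul_rpow hD (by positivity), ← Real.rpow_mul hT.le]; ring_nf
    rw [this]
    have hI2 : D ^ p * T ^ (-(s * p)) / (p * (1 - s)) + D ^ p * T ^ (-(s * p)) / (s * p) ≤ I := by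
      rw [hsplit]
      refine add_le_add ?_ ?_
      · rw [← hTT, mul_div_assoc]; exact l1
      · rw [mul_div_assoc]; exact l2
    calc _ = s * (1 - s) * (D ^ p * T ^ (-(s * p)) / (p * (1 - s)) + D ^ p * T ^ (-(s * p)) / (s * p)) := by
          field_simp; ring
      _ ≤ _ := by gcongr
  have hfin : D * T ^ (-s) / p ^ (1 / p) ≤ (s * (1 - s) * I) ^ (1 / p) := by
    refine le_trans (le_of_eq ?_) (Real.rpow_le_rpow (by positivity) hlow (by positivity))
    rw [Real.div_rpow (by positivity) hp0.le, ← Real.rpow_mul (by positivity), mul_one_div_cancel hp0.ne',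
      Real.rpow_one]
  calc D = p ^ (1 / p) * T ^ s * (D * T ^ (-s) / p ^ (1 / p)) := by
        rw [Real.rpow_neg hT.le]; field_simp
    _ ≤ _ := by gcongr

/-- Translation estimate via the normalised K-interpolation seminorm:
`‖u(·+y) − u‖_{L^p} ≤ p^{1/p} 2^{1−s} |y|^s ( s(1−s) ∫_0^∞ (K̄(t,u)/t^s)^p dt/t )^{1/p}`. -/
theorem translation_le_interpolation_seminorm
    (n : ℕ) (hn : 1 ≤ n) (s p : ℝ) (hs0 : 0 < s) (hs1 : s < 1) (hp : 1 ≤ p)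
    (u : EuclideanSpace ℝ (Fin n) → ℝ)
    (hu : ContDiff ℝ (⊤ : ℕ∞) u) (hsupp : HasCompactSupport u)
    (Kbar : ℝ → ℝ)
    (hKbar : ∀ t : ℝ, Kbar t = sInf {r : ℝ | ∃ v : EuclideanSpace ℝ (Fin n) → ℝ,
      ContDiff ℝ (⊤ : ℕ∞) v ∧ HasCompactSupport v ∧
      r = (eLpNorm (fun x => u x - v x) (ENNReal.ofReal p) volume).toReal +
        t * (eLpNorm (fun x => gradient v x) (ENNReal.ofReal p) volume).toReal}) :
    ∀ y : EuclideanSpace ℝ (Fin n),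
      (eLpNorm (fun x => u (x + y) - u x) (ENNReal.ofReal p) volume).toReal ≤
        p ^ (1 / p) * 2 ^ (1 - s) * ‖y‖ ^ s *
          (s * (1 - s) *
            ∫ t in Set.Ioi (0 : ℝ), (Kbar t / t ^ s) ^ p / t) ^ (1 / p) := by
  intro y
  rcases eq_or_ne y 0 with rfl | hy
  · simp [Real.zero_rpow hs0.ne']
  have hy0 : 0 < ‖y‖ := norm_pos_iff.2 hy
  have hbdd : ∀ t : ℝ, 0 < t → BddBelow {r : ℝ | ∃ v : EuclideanSpace ℝ (Fin n) → ℝ,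
      ContDiff ℝ (⊤ : ℕ∞) v ∧ HasCompactSupport v ∧
      r = (eLpNorm (fun x => u x - v x) (ENNReal.ofReal p) volume).toReal +
        t * (eLpNorm (fun x => gradient v x) (ENNReal.ofReal p) volume).toReal} := by
    intro t ht
    refine ⟨0, ?_⟩
    rintro r ⟨v, -, -, rfl⟩
    positivity
  have hle : ∀ t : ℝ, 0 < t → ∀ v : EuclideanSpace ℝ (Fin n) → ℝ,
      ContDiff ℝ (⊤ : ℕ∞) v → HasCompactSupport v →
      Kbar t ≤ (eLpNorm (fun x => u x - v x) (ENNReal.ofReal p) volume).toReal +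
        t * (eLpNorm (fun x => gradient v x) (ENNReal.ofReal p) volume).toReal := by
    intro t ht v hv hvs
    rw [hKbar]
    exact csInf_le (hbdd t ht) ⟨v, hv, hvs, rfl⟩
  have hge : ∀ t c : ℝ, (∀ v : EuclideanSpace ℝ (Fin n) → ℝ,
      ContDiff ℝ (⊤ : ℕ∞) v → HasCompactSupport v →
      c ≤ (eLpNorm (fun x => u x - v x) (ENNReal.ofReal p) volume).toReal +
        t * (eLpNorm (fun x => gradient v x) (ENNReal.ofReal p) volume).toReal) → c ≤ Kbar t := by
    intro t c h
    rw [hKbar]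
    refine le_csInf ⟨_, u, hu, hsupp, rfl⟩ ?_
    rintro r ⟨v, hv, hvs, rfl⟩
    exact h v hv hvs
  have hz : HasCompactSupport (fun _ : EuclideanSpace ℝ (Fin n) => (0:ℝ)) := HasCompactSupport.zero
  have hmain := scalar_aux s p hs0 hs1 hp Kbar
    ((eLpNorm (fun x => u (x + y) - u x) (ENNReal.ofReal p) volume).toReal / 2) (‖y‖ / 2)
    ((eLpNorm u (ENNReal.ofReal p) volume).toReal)
    ((eLpNorm (fun x => gradient u x) (ENNReal.ofReal p) volume).toReal)
    (by positivity) (by positivity) ?_ ?_ ?_ ?_ ?_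
  · rw [Real.div_rpow hy0.le (by norm_num)] at hmain
    rw [Real.rpow_sub (by norm_num), Real.rpow_one]
    rw [div_le_iff₀ (by norm_num)] at hmain
    refine hmain.trans (le_of_eq ?_)
    ring
  · intro a ha b hb hab
    refine hge b _ fun v hv hvs => (hle a ha v hv hvs).trans ?_
    gcongr
  · intro t ht
    have := hle t ht _ contDiff_const hz
    simpa [gradient] using this
  · intro t ht
    have := hle t ht u hu hsupp
    simpa using this
  · intro t ht htT
    refine hge t _ fun v hv hvs => ?_
    have h := main_aux p hp u v hu hsupp hv hvs y
    set a := (eLpNorm (fun x => u x - v x) (ENNReal.ofReal p) volume).toReal with ha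
    have ha0 : 0 ≤ a := ENNReal.toReal_nonneg
    set b := (eLpNorm (fun x => gradient v x) (ENNReal.ofReal p) volume).toReal
    have hr : t / (‖y‖ / 2) ≤ 1 := by rw [div_le_one (by positivity)]; exact htT
    calc _ ≤ (2 * a + ‖y‖ * b) / 2 * (t / (‖y‖ / 2)) := by gcongr
      _ = a * (t / (‖y‖ / 2)) + t * b := by field_simp; try ring
      _ ≤ a * 1 + t * b := by gcongr
      _ = _ := by ring
  · intro t ht
    refine hge t _ fun v hv hvs => ?_
    have h := main_aux p hp u v hu hsupp hv hvs y
    have hb : 0 ≤ (eLpNorm (fun x => gradient v x) (ENNReal.ofReal p) volume).toReal :=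
      ENNReal.toReal_nonneg
    nlinarith [mul_le_mul_of_nonneg_right ht.le hb]
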